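/- Let ℬ be locally finitely presentable and B an object. The coslice generator 𝒢_B is closed under finite colimits in B↓ℬ: the colimit in B↓ℬ of any finite diagram with values in 𝒢_B again belongs to 𝒢_B. -/

import Mathlib

open CategoryTheory Limits Opposite

universe w v u

section Defs

variable {𝒞 : Type u} [Category.{v} 𝒞]

/-- An object `K` is finitely presented if `Hom(K, -)` preserves filtered colimits. -/
def IsFinPres (K : 𝒞) : Prop :=
  ∀ (J : Type v) (_ : SmallCategory J) (_ : IsFiltered J),
    Nonempty (PreservesColimitsOfShape J (coyoneda.obj (op K)))

/-- A category is locally finitely presentable if it is cocomplete and admits an essentially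
small family of finitely presented objects such that every object is a filtered colimit of
objects of this family. -/
class IsLFP (𝒞 : Type u) [Category.{v} 𝒞] extends HasColimits 𝒞 : Prop where
  exists_gen : ∃ S : Set 𝒞, Small.{v} S ∧ (∀ K ∈ S, IsFinPres K) ∧
    ∀ X : 𝒞, ∃ (J : Type v) (_ : SmallCategory J) (_ : IsFiltered J)
      (D : J ⥤ 𝒞) (c : Cocone D) (_ : Nonempty (IsColimit c)),
      c.pt = X ∧ ∀ j, D.obj j ∈ S

/-- `l : X ⟶ Y` belongs to the coslice generator `𝒢_X`: it is a pushout of a morphism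
between finitely presented objects along a map into `X`. -/
def InGen {X Y : 𝒞} (l : X ⟶ Y) : Prop :=
  ∃ (K K' : 𝒞) (_ : IsFinPres K) (_ : IsFinPres K') (k : K ⟶ K') (a : K ⟶ X)
    (c : K' ⟶ Y), IsPushout a k l c

end Defs

section FinPres

variable {𝒞 : Type u} [Category.{v} 𝒞]

attribute [local instance] Cardinal.fact_isRegular_aleph0

lemma isFinPres_iff_isFinitelyPresentable (K : 𝒞) :
    IsFinPres K ↔ IsFinitelyPresentable.{v} K := by
  rw [isFinitelyPresentable_iff_preservesFilteredColimitsOfSize]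
  refine ⟨fun h ↦ ⟨fun J _ _ ↦ (h J _ inferInstance).some⟩, fun h J _ _ ↦ ⟨?_⟩⟩
  exact PreservesFilteredColimitsOfSize.preserves_filtered_colimits J

lemma isFinPres_colimit {K : Type*} [Category K] [FinCategory K] (Y : K ⥤ 𝒞) [HasColimit Y]
    (h : ∀ k, IsFinPres (Y.obj k)) : IsFinPres (colimit Y) := by
  simp only [isFinPres_iff_isFinitelyPresentable] at h ⊢
  exact isCardinalPresentable_of_isColimit' _ (colimit.isColimit Y) _
    ((hasCardinalLT_aleph0_iff _).2 inferInstance)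

lemma isFinPres_pushout {X Y Z : 𝒞} (f : X ⟶ Y) (g : X ⟶ Z) [HasPushout f g]
    (hX : IsFinPres X) (hY : IsFinPres Y) (hZ : IsFinPres Z) : IsFinPres (pushout f g) :=
  isFinPres_colimit _ (by rintro (_ | _ | _) <;> assumption)

lemma isFinPres_coequalizer {X Y : 𝒞} (f g : X ⟶ Y) [HasCoequalizer f g]
    (hX : IsFinPres X) (hY : IsFinPres Y) : IsFinPres (coequalizer f g) :=
  isFinPres_colimit _ (by rintro (_ | _) <;> assumption)

lemma isFinPres_sigma {ι : Type*} [Finite ι] (X : ι → 𝒞) [HasCoproduct X]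
    (h : ∀ i, IsFinPres (X i)) : IsFinPres (∐ X) := by
  have := Fintype.ofFinite ι
  classical exact isFinPres_colimit _ (fun i ↦ h i.as)

lemma isFinPres_coprod {X Y : 𝒞} [HasBinaryCoproduct X Y] (hX : IsFinPres X) (hY : IsFinPres Y) :
    IsFinPres (X ⨿ Y) :=
  isFinPres_colimit _ (by rintro ⟨_ | _⟩ <;> assumption)

lemma IsFinPres.exists_hom_of_isColimit {L : 𝒞} (hL : IsFinPres L) {J : Type v} [SmallCategory J]
    [IsFiltered J] {D : J ⥤ 𝒞} {c : Cocone D} (hc : IsColimit c) (u : L ⟶ c.pt) :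
    ∃ (j : J) (p : L ⟶ D.obj j), p ≫ c.ι.app j = u := by
  rw [isFinPres_iff_isFinitelyPresentable] at hL
  exact IsFinitelyPresentable.exists_hom_of_isColimit hc u

end FinPres

section Gen

variable {𝒞 : Type u} [Category.{v} 𝒞]

attribute [local simp] pushout.inl_desc pushout.inl_desc_assoc pushout.inr_desc
  pushout.inr_desc_assoc

/-- The objectwise pushout of `k` along a natural family of maps out of `K`. -/
noncomputable abbrev pushoutFunctor [HasPushouts 𝒞] {J : Type*} [Category J] {K K' : 𝒞}
    (k : K ⟶ K') {D : J ⥤ 𝒞} (α : ∀ j, K ⟶ D.obj j)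
    (hα : ∀ ⦃i j⦄ (f : i ⟶ j), α i ≫ D.map f = α j) : J ⥤ 𝒞 where
  obj j := pushout (α j) k
  map {i j} f := pushout.map _ _ _ _ (D.map f) (𝟙 _) (𝟙 _) (by simp [hα]) (by simp)
  map_comp f g := by ext <;> simp

/-- The cocone over `pushoutFunctor k α hα` with point a pushout of `k` along the induced map. -/
noncomputable abbrev pushoutCocone [HasPushouts 𝒞] {J : Type*} [Category J] {K K' Y : 𝒞}
    {k : K ⟶ K'} {D : J ⥤ 𝒞} {α : ∀ j, K ⟶ D.obj j}
    (hα : ∀ ⦃i j⦄ (f : i ⟶ j), α i ≫ D.map f = α j) {e : Cocone D}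
    {a : K ⟶ e.pt} {l : e.pt ⟶ Y} {c : K' ⟶ Y} (sq : IsPushout a k l c)
    (h : ∀ j, α j ≫ e.ι.app j = a) : Cocone (pushoutFunctor k α hα) where
  pt := Y
  ι.app j := pushout.desc (e.ι.app j ≫ l) c (by rw [reassoc_of% (h j), sq.w])
  ι.naturality i j f := by
    dsimp
    ext <;> simp

/-- Connected colimits commute with pushouts of a fixed map. -/
lemma nonempty_isColimit_pushoutCocone [HasPushouts 𝒞] {J : Type*} [Category J] [IsConnected J]
    {K K' Y : 𝒞} {k : K ⟶ K'} {D : J ⥤ 𝒞} {α : ∀ j, K ⟶ D.obj j}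
    (hα : ∀ ⦃i j⦄ (f : i ⟶ j), α i ≫ D.map f = α j) {e : Cocone D} (he : IsColimit e)
    {a : K ⟶ e.pt} {l : e.pt ⟶ Y} {c : K' ⟶ Y} (sq : IsPushout a k l c)
    (h : ∀ j, α j ≫ e.ι.app j = a) : Nonempty (IsColimit (pushoutCocone hα sq h)) := by
  have j₀ : J := Classical.arbitrary J
  let t (s : Cocone (pushoutFunctor k α hα)) : Cocone D :=
    { pt := s.pt
      ι.app j := pushout.inl (α j) k ≫ s.ι.app j
      ι.naturality i j f := by simp [← s.w f] }
  have hinr (s : Cocone (pushoutFunctor k α hα)) (j : J) :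
      pushout.inr (α j) k ≫ s.ι.app j = pushout.inr (α j₀) k ≫ s.ι.app j₀ :=
    constant_of_preserves_morphisms
      (fun j ↦ (pushout.inr (α j) k ≫ s.ι.app j : K' ⟶ s.pt))
      (fun i j f ↦ by simp [← s.w f]) j j₀
  have hinl (s : Cocone (pushoutFunctor k α hα)) (j : J) :
      e.ι.app j ≫ he.desc (t s) = pushout.inl (α j) k ≫ s.ι.app j := he.fac (t s) j
  refine ⟨{
    desc s := sq.desc (he.desc (t s)) (pushout.inr (α j₀) k ≫ s.ι.app j₀) ?_
    fac s j := ?_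
    uniq s m hm := ?_ }⟩
  · rw [← h j₀, Category.assoc, hinl, pushout.condition_assoc]
  · dsimp
    ext
    · simp [hinl]
    · simp [hinr]
  · refine sq.hom_ext ?_ ?_
    · refine he.hom_ext fun j ↦ ?_
      simp [hinl, ← hm]
    · simp [← hm]

/-- A map from a finitely presented object to the codomain of a member of the coslice generator
factors through a suitable presentation. -/
lemma InGen.exists_factorization [IsLFP 𝒞] {X Y L : 𝒞} {l : X ⟶ Y} (hl : InGen l)
    (hL : IsFinPres L) (u : L ⟶ Y) :
    ∃ (K K' : 𝒞) (_ : IsFinPres K) (_ : IsFinPres K') (k : K ⟶ K') (a : K ⟶ X)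
      (c : K' ⟶ Y) (_ : IsPushout a k l c) (u' : L ⟶ K'), u' ≫ c = u := by
  obtain ⟨K, K', hK, hK', k, a, c, sq⟩ := hl
  obtain ⟨S, -, hS, hS'⟩ := IsLFP.exists_gen (𝒞 := 𝒞)
  obtain ⟨J, _, _, D, e, ⟨he⟩, rfl, hD⟩ := hS' X
  obtain ⟨j₀, a₀, ha₀⟩ := hK.exists_hom_of_isColimit he a
  let α (j : Under j₀) : K ⟶ (Under.forget j₀ ⋙ D).obj j := a₀ ≫ D.map j.hom
  have hα ⦃i j : Under j₀⦄ (f : i ⟶ j) : α i ≫ (Under.forget j₀ ⋙ D).map f = α j := by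
    simp [α, ← Functor.map_comp]
  have he' := (Functor.Final.isColimitWhiskerEquiv (Under.forget j₀) _).symm he
  have h (j : Under j₀) : α j ≫ e.ι.app j.right = a := by simp [α, ha₀]
  have : IsConnected (Under j₀) := IsFiltered.isConnected _
  obtain ⟨hY⟩ := nonempty_isColimit_pushoutCocone hα he' sq h
  obtain ⟨j, u', hu'⟩ := hL.exists_hom_of_isColimit hY u
  refine ⟨D.obj j.right, pushout (α j) k, hS _ (hD _),
    isFinPres_pushout _ _ hK (hS _ (hD _)) hK', pushout.inl _ _, e.ι.app j.right, _,
    (IsPushout.of_top ?_ (pushout.inl_desc _ _ _) (IsPushout.of_hasPushout (α j) k).flip).flip,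
    u', hu'⟩
  convert sq.flip
  exacts [h j, pushout.inr_desc _ _ _]

/-- Identifying two maps out of a finitely presented object preserves the coslice generator. -/
lemma InGen.comp_coequalizer [IsLFP 𝒞] {X Y L : 𝒞} {l : X ⟶ Y} (hl : InGen l)
    (hL : IsFinPres L) (u v : L ⟶ Y) : InGen (l ≫ coequalizer.π u v) := by
  obtain ⟨K, K', hK, hK', k, a, c, sq, w, hw⟩ :=
    hl.exists_factorization (isFinPres_coprod hL hL) (coprod.desc u v)
  have hu : (coprod.inl ≫ w) ≫ c = u := by rw [Category.assoc, hw, coprod.inl_desc]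
  have hv : (coprod.inr ≫ w) ≫ c = v := by rw [Category.assoc, hw, coprod.inr_desc]
  generalize coprod.inl ≫ w = u' at hu
  generalize coprod.inr ≫ w = v' at hv
  subst hu hv
  have sq' : IsPushout c (coequalizer.π u' v') (coequalizer.π (u' ≫ c) (v' ≫ c))
      (coequalizer.desc (c ≫ coequalizer.π (u' ≫ c) (v' ≫ c))
        (by simpa using coequalizer.condition (u' ≫ c) (v' ≫ c))) := by
    refine ⟨⟨by simp⟩, ⟨PushoutCocone.IsColimit.mk _
      (fun s ↦ coequalizer.desc s.inl ?_) ?_ ?_ ?_⟩⟩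
    · simp [s.condition, coequalizer.condition_assoc u' v']
    · simp
    · intro s
      ext
      simp [s.condition]
    · intro s m h₁ h₂
      ext
      simp [h₁]
  exact ⟨K, _, hK, isFinPres_coequalizer u' v' hL hK', _, a, _,
    sq.flip.paste_horiz sq'.flip |>.flip⟩

lemma InGen.of_iso {B : 𝒞} {X Y : Under B} (e : X ≅ Y) (h : InGen X.hom) : InGen Y.hom := by
  obtain ⟨K, K', hK, hK', k, a, c, sq⟩ := h
  exact ⟨K, K', hK, hK', k, a, c ≫ e.hom.right,
    sq.of_iso (Iso.refl _) (Iso.refl _) (Iso.refl _) ((Under.forget B).mapIso e)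
      (by simp) (by simp) (by simp) (by simp)⟩

end Gen

/-- The coslice generator `𝒢_B` is closed under finite colimits in `B↓ℬ`: the colimit of
any finite diagram of objects of `𝒢_B` again lies in `𝒢_B`. -/
theorem stmt9 {ℬ : Type u} [Category.{v} ℬ] [IsLFP ℬ] (B : ℬ)
    (I : Type v) [SmallCategory I] [FinCategory I] (F : I ⥤ Under B)
    (h : ∀ i, InGen (F.obj i).hom) (c : Cocone F) (hc : IsColimit c) :
    InGen c.pt.hom := by
  choose K K' hK hK' k a b sq using h
  let C := pushout (Sigma.desc a) (Limits.Sigma.map k)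
  let p : B ⟶ C := pushout.inl _ _
  let q (i : I) : K' i ⟶ C := Sigma.ι K' i ≫ pushout.inr _ _
  have hp : InGen p := ⟨_, _, isFinPres_sigma K hK, isFinPres_sigma K' hK', _, _, _,
    IsPushout.of_hasPushout _ _⟩
  have hpq (i : I) : a i ≫ p = k i ≫ q i := by
    simpa using Sigma.ι K i ≫= pushout.condition (f := Sigma.desc a) (g := Limits.Sigma.map k)
  let r (i : I) : (F.obj i).right ⟶ C := (sq i).desc p (q i) (hpq i)
  have hr₁ (i : I) : (F.obj i).hom ≫ r i = p := (sq i).inl_desc ..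
  have hr₂ (i : I) : b i ≫ r i = q i := (sq i).inr_desc ..
  let L (f : Σ i j : I, i ⟶ j) : ℬ := K' f.1
  let u : ∐ L ⟶ C := Sigma.desc fun f ↦ q f.1
  let v : ∐ L ⟶ C := Sigma.desc fun f ↦ b f.1 ≫ (F.map f.2.2).right ≫ r f.2.1
  have hL : IsFinPres (∐ L) := isFinPres_sigma L fun f ↦ hK' f.1
  let d : Cocone F :=
    { pt := Under.mk (p ≫ coequalizer.π u v)
      ι.app i := Under.homMk (r i ≫ coequalizer.π u v) (by simp [reassoc_of% hr₁])
      ι.naturality i j f := by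
        ext
        refine (sq i).hom_ext ?_ ?_
        · simp [reassoc_of% hr₁]
        · have := Sigma.ι L ⟨i, j, f⟩ ≫= coequalizer.condition u v
          simpa [u, v, reassoc_of% hr₂] using this.symm }
  let desc₀ (s : Cocone F) : C ⟶ s.pt.right := pushout.desc s.pt.hom
    (Sigma.desc fun i ↦ b i ≫ (s.ι.app i).right) (by ext i; simp [← (sq i).w_assoc])
  have hp' (s : Cocone F) : p ≫ desc₀ s = s.pt.hom := pushout.inl_desc _ _ _
  have hq (s : Cocone F) (i : I) : q i ≫ desc₀ s = b i ≫ (s.ι.app i).right := by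
    simp [q, desc₀, pushout.inr_desc]
  have hr (s : Cocone F) (i : I) : r i ≫ desc₀ s = (s.ι.app i).right :=
    (sq i).hom_ext (by simp [reassoc_of% hr₁, hp']) (by simp [reassoc_of% hr₂, hq])
  have huv (s : Cocone F) : u ≫ desc₀ s = v ≫ desc₀ s := by
    ext ⟨i, j, f⟩
    have := congrArg Under.Hom.right (s.w f)
    dsimp at this
    simp [u, v, hq, hr, this]
  have hd : IsColimit d :=
    { desc s := Under.homMk (coequalizer.desc (desc₀ s) (huv s)) (by simp [d, hp'])
      fac s i := by
        ext
        simp [d, hr]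
      uniq s m hm := by
        ext
        refine coequalizer.hom_ext (pushout.hom_ext ?_ (Sigma.hom_ext _ _ fun i ↦ ?_))
        · simpa [d, hp', p] using Under.w m
        · have := b i ≫= congrArg Under.Hom.right (hm i)
          simpa [d, q, desc₀, reassoc_of% hr₂, pushout.inr_desc] using this }
  exact (hp.comp_coequalizer hL u v).of_iso (hd.coconePointUniqueUpToIso hc)
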